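/- Let α, β be coprime integers with 2 ≤ α < β and Γ = ⟨α, β⟩. Then the number of sets Δ ⊆ ℕ with 0 ∈ Δ and Δ + Γ ⊆ Δ that are selfdual equals the binomial coefficient C(⌊α/2⌋ + ⌊β/2⌋, ⌊α/2⌋). -/

import Mathlib

/-- The numerical semigroup `⟨α, β⟩ = {pα + qβ : p, q ∈ ℕ}`, viewed inside `ℤ`. -/
def Gamma (α β : ℕ) : Set ℤ := {x : ℤ | ∃ p q : ℕ, x = (p : ℤ) * α + (q : ℤ) * β}

/-- The dual `Δ* = {c ∈ ℤ : c + Δ ⊆ ⟨α,β⟩}` of an `⟨α,β⟩`-semimodule. -/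
def dualSet (α β : ℕ) (Δ : Set ℤ) : Set ℤ := {c : ℤ | ∀ x ∈ Δ, c + x ∈ Gamma α β}

/-- A normalized `⟨α,β⟩`-semimodule: a subset of `ℕ` containing `0`
with `Δ + Γ ⊆ Δ`. -/
def IsNormalizedSemimodule (α β : ℕ) (Δ : Set ℤ) : Prop :=
  (0 : ℤ) ∈ Δ ∧ (∀ x ∈ Δ, 0 ≤ x) ∧ ∀ x ∈ Δ, ∀ γ ∈ Gamma α β, x + γ ∈ Δ

/-- `Δ` is selfdual if `Δ*` is a shift of `Δ`. -/
def IsSelfdual (α β : ℕ) (Δ : Set ℤ) : Prop :=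
  ∃ c : ℤ, dualSet α β Δ = (fun x => c + x) '' Δ

/-- `E` is the minimal system of generators of `Δ`: it generates `Δ`
(`⋃_{x∈E}(x+Γ) = Δ`) and no proper subset of it generates `Δ`. -/
def IsMinGenSet (α β : ℕ) (Δ : Set ℤ) (E : Finset ℤ) : Prop :=
  (↑E ⊆ Δ) ∧ (⋃ x ∈ (E : Set ℤ), (fun γ => x + γ) '' Gamma α β) = Δ ∧
    ∀ F : Finset ℤ, F ⊂ E → (⋃ x ∈ (F : Set ℤ), (fun γ => x + γ) '' Gamma α β) ≠ Δ

theorem gamma_rep (α β : ℕ) (hα : 0 < α) (hβ : 0 < β) (hcop : Nat.Coprime α β) (x : ℤ) :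
    ∃ k l : ℤ, 0 ≤ k ∧ k < β ∧ x = k * α + l * β := by
  have hb : (α : ℤ) * Nat.gcdA α β + β * Nat.gcdB α β = 1 := by
    rw [← Nat.gcd_eq_gcd_ab, hcop]; simp
  have hβ' : (0:ℤ) < β := by exact_mod_cast hβ
  set u := Nat.gcdA α β
  set v := Nat.gcdB α β
  refine ⟨(x * u) % β, x * v + (x * u) / β * α, Int.emod_nonneg _ hβ'.ne', Int.emod_lt_of_pos _ hβ', ?_⟩
  have h := Int.emod_add_mul_ediv (x * u) β
  have : (x * u) % β = x * u - β * ((x * u) / β) := by linarith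
  rw [this]
  linear_combination (-x) * hb

theorem gamma_iff (α β : ℕ) (hα : 0 < α) (hβ : 0 < β) (hcop : Nat.Coprime α β) (k l : ℤ)
    (hk : 0 ≤ k) (hk' : k < β) : k * α + l * β ∈ Gamma α β ↔ 0 ≤ l := by
  have hβ' : (0:ℤ) < β := by exact_mod_cast hβ
  have hα' : (0:ℤ) < α := by exact_mod_cast hα
  constructor
  · rintro ⟨p, q, h⟩
    have hd : (β : ℤ) ∣ (p - k) := by
      have : IsCoprime (β : ℤ) (α : ℤ) := (Nat.isCoprime_iff_coprime.mpr hcop).symm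
      apply this.dvd_of_dvd_mul_right
      exact ⟨l - q, by linear_combination -h⟩
    obtain ⟨t, ht⟩ := hd
    have ht0 : 0 ≤ t := by
      by_contra hc
      have : t ≤ -1 := by omega
      have : (β:ℤ) * t ≤ β * (-1) := mul_le_mul_of_nonneg_left this hβ'.le
      have := Int.natCast_nonneg p
      linarith
    have hp : (p:ℤ) = k + β * t := by linarith
    rw [hp] at h
    have : (β:ℤ) * l = β * (t * α + q) := by linear_combination h
    have := mul_left_cancel₀ hβ'.ne' this
    rw [this]; positivity
  · intro hl
    exact ⟨k.toNat, l.toNat, by rw [Int.toNat_of_nonneg hk, Int.toNat_of_nonneg hl]⟩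

theorem gamma_symm (α β : ℕ) (hα : 0 < α) (hβ : 0 < β) (hcop : Nat.Coprime α β) (x : ℤ) :
    x ∈ Gamma α β ↔ (α * β - α - β : ℤ) - x ∉ Gamma α β := by
  obtain ⟨k, l, h0, h1, rfl⟩ := gamma_rep α β hα hβ hcop x
  have : (α * β - α - β : ℤ) - (k * α + l * β) = (β - 1 - k) * α + (-1 - l) * β := by ring
  rw [this, gamma_iff α β hα hβ hcop _ _ h0 h1,
    gamma_iff α β hα hβ hcop _ _ (by omega) (by omega)]
  omega

theorem zero_mem_gamma (α β : ℕ) : (0:ℤ) ∈ Gamma α β := ⟨0, 0, by simp⟩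

theorem selfdual_iff (α β : ℕ) (hα : 0 < α) (hβ : 0 < β) (hcop : Nat.Coprime α β) (Δ : Set ℤ)
    (hΔ : ∀ x ∈ Δ, ∀ γ ∈ Gamma α β, x + γ ∈ Δ) :
    IsSelfdual α β Δ ↔ ∃ N : ℤ, ∀ x, x ∈ Δ ↔ N - x ∉ Δ := by
  have key : ∀ c, c ∈ dualSet α β Δ ↔ (α * β - α - β : ℤ) - c ∉ Δ := by
    intro c
    constructor
    · intro h hc
      have h1 := h _ hc
      rw [gamma_symm α β hα hβ hcop] at h1
      apply h1
      convert zero_mem_gamma α β using 1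
      ring
    · intro h x hx
      rw [gamma_symm α β hα hβ hcop]
      intro h1
      apply h
      convert hΔ x hx _ h1 using 1
      ring
  have im : ∀ c y, y ∈ (fun x => c + x) '' Δ ↔ y - c ∈ Δ := by
    intro c y
    constructor
    · rintro ⟨x, hx, rfl⟩; simpa using hx
    · intro h; exact ⟨_, h, by simp⟩
  constructor
  · rintro ⟨c, hc⟩
    refine ⟨(α * β - α - β : ℤ) - c, fun x => ?_⟩
    have h1 := key (c + x)
    rw [hc, im] at h1
    rw [add_sub_cancel_left] at h1
    rw [h1, sub_sub _ c x]
  · rintro ⟨N, hN⟩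
    refine ⟨(α * β - α - β : ℤ) - N, ?_⟩
    ext y
    rw [key, im, hN]
    ring_nf
    exact not_not

/-- Semimodules with centre of symmetry fixed. -/
def TT (α β : ℕ) : Set (Set ℤ) :=
  {Δ | (∀ x ∈ Δ, x + α ∈ Δ) ∧ (∀ x ∈ Δ, x + β ∈ Δ) ∧ ∀ x, x ∈ Δ ↔ -(β:ℤ) - x ∉ Δ}

theorem add_gamma (α β : ℕ) (Δ : Set ℤ) (h1 : ∀ x ∈ Δ, x + α ∈ Δ) (h2 : ∀ x ∈ Δ, x + β ∈ Δ) :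
    ∀ x ∈ Δ, ∀ γ ∈ Gamma α β, x + γ ∈ Δ := by
  have A : ∀ p : ℕ, ∀ x ∈ Δ, x + p * α ∈ Δ := by
    intro p
    induction p with
    | zero => intro x hx; simpa using hx
    | succ p ih => intro x hx; convert h1 _ (ih x hx) using 1; push_cast; ring
  have B : ∀ p : ℕ, ∀ x ∈ Δ, x + p * β ∈ Δ := by
    intro p
    induction p with
    | zero => intro x hx; simpa using hx
    | succ p ih => intro x hx; convert h2 _ (ih x hx) using 1; push_cast; ring
  rintro x hx γ ⟨p, q, rfl⟩
  rw [← add_assoc]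
  exact B q _ (A p x hx)

theorem gamma_large (α β : ℕ) (hα : 0 < α) (hβ : 0 < β) (hcop : Nat.Coprime α β) (x : ℤ)
    (hx : (α * β : ℤ) ≤ x) : x ∈ Gamma α β := by
  rw [gamma_symm α β hα hβ hcop]
  rintro ⟨p, q, h⟩
  have : (0:ℤ) ≤ p * α + q * β := by positivity
  omega

theorem TT_bdd (α β : ℕ) (hα : 0 < α) (hβ : 0 < β) (hcop : Nat.Coprime α β) (Δ : Set ℤ)
    (h : Δ ∈ TT α β) : Δ.Nonempty ∧ BddBelow Δ := by
  obtain ⟨h1, h2, h3⟩ := h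
  have hg := add_gamma α β Δ h1 h2
  constructor
  · by_contra hc
    rw [Set.not_nonempty_iff_eq_empty] at hc
    subst hc
    simpa using h3 0
  · have : ∃ y, y ∉ Δ := by
      by_contra hc
      push Not at hc
      exact (h3 0).1 (hc 0) (hc _)
    obtain ⟨y, hy⟩ := this
    refine ⟨y - α * β, fun x hx => ?_⟩
    by_contra hc
    apply hy
    have := hg x hx (y - x) (gamma_large α β hα hβ hcop _ (by linarith))
    simpa using this

theorem sym_unique (D : Set ℤ) (hne : D.Nonempty) (hb : BddBelow D) (N N' : ℤ)
    (h : ∀ x, x ∈ D ↔ N - x ∉ D) (h' : ∀ x, x ∈ D ↔ N' - x ∉ D) : N ≤ N' := by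
  by_contra hc
  have hm := Int.csInf_mem hne hb
  have e : ∀ x, x ∈ D → x - (N - N') ∈ D := by
    intro x hx
    have h1 := (h x).1 hx
    rw [h' (x - (N - N'))]
    convert h1 using 2
    ring
  have := csInf_le hb (e _ hm)
  omega

theorem ncard_S_TT (α β : ℕ) (hα : 0 < α) (hβ : 0 < β) (hcop : Nat.Coprime α β) (hodd : Odd β) :
    (TT α β).ncard = {Δ : Set ℤ | IsNormalizedSemimodule α β Δ ∧ IsSelfdual α β Δ}.ncard := by
  refine Set.ncard_congr (fun Δ _ => {x | x + sInf Δ ∈ Δ}) ?_ ?_ ?_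
  · intro Δ hΔ
    obtain ⟨hne, hb⟩ := TT_bdd α β hα hβ hcop Δ hΔ
    obtain ⟨h1, h2, h3⟩ := hΔ
    have hg := add_gamma α β Δ h1 h2
    have hg' : ∀ x ∈ {x | x + sInf Δ ∈ Δ}, ∀ γ ∈ Gamma α β, x + γ ∈ {x | x + sInf Δ ∈ Δ} := by
      intro x hx γ hγ
      have := hg _ hx γ hγ
      simp only [Set.mem_ofPred_eq]
      convert this using 1; ring
    refine ⟨⟨?_, ?_, hg'⟩, ?_⟩
    · simpa using Int.csInf_mem hne hb
    · intro x hx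
      have := csInf_le hb hx
      linarith
    · rw [selfdual_iff α β hα hβ hcop _ hg']
      refine ⟨-β - 2 * sInf Δ, fun x => ?_⟩
      simp only [Set.mem_ofPred_eq]
      rw [h3]
      ring_nf
  · intro Δ Δ' hΔ hΔ' heq
    obtain ⟨hne, hb⟩ := TT_bdd α β hα hβ hcop Δ hΔ
    obtain ⟨h1, h2, h3⟩ := hΔ
    obtain ⟨h1', h2', h3'⟩ := hΔ'
    set D := {x | x + sInf Δ ∈ Δ} with hD
    have s1 : ∀ x, x ∈ D ↔ (-β - 2 * sInf Δ) - x ∉ D := by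
      intro x
      simp only [hD, Set.mem_ofPred_eq]
      rw [h3]
      ring_nf
    have s2 : ∀ x, x ∈ D ↔ (-β - 2 * sInf Δ') - x ∉ D := by
      intro x
      rw [heq]
      simp only [Set.mem_ofPred_eq]
      rw [h3']
      ring_nf
    have dne : D.Nonempty := ⟨0, by simpa [hD] using Int.csInf_mem hne hb⟩
    have db : BddBelow D := ⟨0, fun x hx => by
      have := csInf_le hb hx
      linarith⟩
    have e1 := sym_unique D dne db _ _ s1 s2
    have e2 := sym_unique D dne db _ _ s2 s1
    have e : sInf Δ = sInf Δ' := by omega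
    ext x
    have : x - sInf Δ ∈ D ↔ x - sInf Δ ∈ {x | x + sInf Δ' ∈ Δ'} := by rw [heq]
    rw [hD] at this
    simp only [Set.mem_ofPred_eq, ← e] at this
    simpa using this
  · rintro D ⟨⟨h0, hpos, hg⟩, hs⟩
    rw [selfdual_iff α β hα hβ hcop _ hg] at hs
    obtain ⟨N, hN⟩ := hs
    have hNodd : ∃ s : ℤ, N = -β - 2 * s := by
      obtain ⟨b, hb⟩ := hodd
      rcases Int.even_or_odd' N with ⟨t, ht | ht⟩
      · have := hN t
        rw [ht, show 2 * t - t = t by ring] at this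
        tauto
      · exact ⟨-b - 1 - t, by rw [ht, hb]; push_cast; ring⟩
    obtain ⟨s, rfl⟩ := hNodd
    have hinf : sInf {x : ℤ | x - s ∈ D} = s := by
      apply IsLeast.csInf_eq
      refine ⟨by simpa using h0, fun x hx => ?_⟩
      have := hpos _ hx
      linarith
    refine ⟨{x | x - s ∈ D}, ⟨?_, ?_, ?_⟩, ?_⟩
    · intro x hx
      have := hg _ hx α ⟨1, 0, by simp⟩
      simp only [Set.mem_ofPred_eq]
      convert this using 1; ring
    · intro x hx
      have := hg _ hx β ⟨0, 1, by simp⟩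
      simp only [Set.mem_ofPred_eq]
      convert this using 1; ring
    · intro x
      simp only [Set.mem_ofPred_eq]
      rw [hN]
      ring_nf
    · simp [hinf]

/-- Boundary functions. -/
def GG (α β : ℕ) (g : ℤ → ℤ) : Prop :=
  (∀ k, g k ≤ g (k + 1) ∧ g (k + 1) ≤ g k + 1) ∧ (∀ k, g (k + (α + β)) = g k + α) ∧
    ∀ k, g k + g (1 - k) = 0

/-- The semimodule of a boundary function. -/
def DD (α β : ℕ) (g : ℤ → ℤ) : Set ℤ :=
  {x | ∃ k l : ℤ, x = k * α + (α + β) * l ∧ 0 ≤ l + g k}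

theorem GG_per (α β : ℕ) (g : ℤ → ℤ) (h : GG α β g) (k t : ℤ) :
    g (k + (α + β) * t) = g k + α * t := by
  induction t using Int.induction_on with
  | zero => simp
  | succ i ih =>
    have := h.2.1 (k + (α + β) * i)
    rw [show k + (α + β) * ((i:ℤ) + 1) = k + (α + β) * i + (α + β) by ring, this, ih]; ring
  | pred i ih =>
    have := h.2.1 (k + (α + β) * (-i - 1))
    rw [show k + (α + β) * (-(i:ℤ) - 1) + (α + β) = k + (α + β) * (-i) by ring, ih] at this
    linarith

theorem mem_DD (α β : ℕ) (hα : 0 < α) (hcop : Nat.Coprime α β) (g : ℤ → ℤ)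
    (h : ∀ k t : ℤ, g (k + (α + β) * t) = g k + α * t) (k l : ℤ) :
    k * α + (α + β) * l ∈ DD α β g ↔ 0 ≤ l + g k := by
  constructor
  · rintro ⟨k', l', he, h'⟩
    have hd : ((α + β : ℤ)) ∣ (k - k') := by
      have : IsCoprime (α + β : ℤ) (α : ℤ) := by
        have := (Nat.isCoprime_iff_coprime.mpr hcop).symm
        simpa [add_comm] using this.add_mul_left_left 1
      apply this.dvd_of_dvd_mul_right
      exact ⟨l' - l, by linear_combination he⟩
    obtain ⟨t, ht⟩ := hd
    have hk : k = k' + (α + β) * t := by linarith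
    rw [hk, h]
    have hn : (0:ℤ) < α + β := by positivity
    have : (α + β : ℤ) * l' = (α + β) * (l + α * t) := by rw [hk] at he; linear_combination -he
    have := mul_left_cancel₀ hn.ne' this
    linarith
  · intro h'; exact ⟨k, l, rfl, h'⟩

theorem rep_n (α β : ℕ) (hcop : Nat.Coprime α β) (x : ℤ) :
    ∃ k l : ℤ, x = k * α + (α + β) * l := by
  have hb : (α : ℤ) * Nat.gcdA α β + β * Nat.gcdB α β = 1 := by
    rw [← Nat.gcd_eq_gcd_ab, hcop]; simp
  exact ⟨x * (Nat.gcdA α β - Nat.gcdB α β), x * Nat.gcdB α β, by linear_combination (-x) * hb⟩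

theorem DD_mem (α β : ℕ) (hα : 0 < α) (hcop : Nat.Coprime α β) (g : ℤ → ℤ)
    (h : GG α β g) : DD α β g ∈ TT α β := by
  have M := mem_DD α β hα hcop g (GG_per α β g h)
  obtain ⟨h1, h2, h3⟩ := h
  refine ⟨?_, ?_, ?_⟩
  · rintro x ⟨k, l, rfl, hl⟩
    refine ⟨k + 1, l, by ring, ?_⟩
    have := h1 k
    linarith
  · rintro x ⟨k, l, rfl, hl⟩
    refine ⟨k - 1, l + 1, by ring, ?_⟩
    have := h1 (k - 1)
    rw [sub_add_cancel] at this
    linarith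
  · intro x
    obtain ⟨k, l, rfl⟩ := rep_n α β hcop x
    rw [show -(β:ℤ) - (k * α + (α + β) * l) = (1 - k) * α + (α + β) * (-l - 1) by ring, M, M]
    have := h3 k
    omega

theorem TT_exists (α β : ℕ) (hα : 0 < α) (hβ : 0 < β) (hcop : Nat.Coprime α β) (Δ : Set ℤ)
    (hΔ : Δ ∈ TT α β) : ∃ g, GG α β g ∧ Δ = DD α β g := by
  obtain ⟨hne, hb⟩ := TT_bdd α β hα hβ hcop Δ hΔ
  obtain ⟨h1, h2, h3⟩ := hΔ
  have hg := add_gamma α β Δ h1 h2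
  have hn : (0:ℤ) < α + β := by positivity
  have ex : ∀ k : ℤ, ∃ g : ℤ, ∀ l : ℤ, k * α + (α + β) * l ∈ Δ ↔ 0 ≤ l + g := by
    intro k
    obtain ⟨b, hb⟩ := hb
    obtain ⟨y, hy⟩ := hne
    obtain ⟨m, hm, hm'⟩ := Int.exists_least_of_bdd (P := fun l => k * α + (α + β) * l ∈ Δ)
      ⟨-|b - k * α|, fun l hl => by
        by_contra hc
        have h4 := hb hl
        have h5 : l ≤ -|b - k * α| - 1 := by omega
        have h6 := mul_le_mul_of_nonneg_left h5 hn.le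
        have h7 := neg_abs_le (b - k * α)
        have h8 : 1 * |b - k * α| ≤ (α + β) * |b - k * α| :=
          mul_le_mul_of_nonneg_right (by omega) (abs_nonneg _)
        nlinarith⟩
      ⟨|y + α * β - k * α|, by
        have h7 := le_abs_self (y + α * β - k * α)
        have h8 : 1 * |y + α * β - k * α| ≤ (α + β) * |y + α * β - k * α| :=
          mul_le_mul_of_nonneg_right (by omega) (abs_nonneg _)
        have := hg y hy (k * α + (α + β) * |y + α * β - k * α| - y)
          (gamma_large α β hα hβ hcop _ (by linarith))
        simpa using this⟩
    refine ⟨-m, fun l => ⟨fun h => by have := hm' l h; linarith, fun h => ?_⟩⟩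
    have := hg _ hm ((α + β) * (l - m)) ⟨(l - m).toNat, (l - m).toNat, by
      rw [Int.toNat_of_nonneg (by linarith)]; ring⟩
    convert this using 1; ring
  choose g hgl using ex
  have G : GG α β g := by
    refine ⟨fun k => ⟨?_, ?_⟩, fun k => ?_, fun k => ?_⟩
    · have a := (hgl k (-g k)).2 (by simp)
      have a := h1 _ a
      rw [show k * α + (α + β) * -g k + α = (k + 1) * α + (α + β) * -g k by ring, hgl] at a
      linarith
    · have a := (hgl (k + 1) (-g (k + 1))).2 (by simp)
      have a := h2 _ a
      rw [show (k + 1) * α + (α + β) * -g (k + 1) + β = k * α + (α + β) * (-g (k + 1) + 1) by ring,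
        hgl] at a
      linarith
    · have e : ∀ l, 0 ≤ l - α + g (k + (α + β)) ↔ 0 ≤ l + g k := by
        intro l
        rw [← hgl, ← hgl]
        ring_nf
      have a := e (-g k)
      have b := e (α - g (k + (α + β)))
      omega
    · have e : ∀ l, 0 ≤ l + g k ↔ ¬ 0 ≤ (-l - 1) + g (1 - k) := by
        intro l
        rw [← hgl, ← hgl, h3]
        ring_nf
      have a := e (-g k)
      have b := e (g (1 - k))
      omega
  refine ⟨g, G, ?_⟩
  ext x
  obtain ⟨k, l, rfl⟩ := rep_n α β hcop x
  rw [mem_DD α β hα hcop g (GG_per α β g G), hgl]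

/-- counting function -/
def cc (A : Finset ℕ) (j : ℕ) : ℕ := (A.filter (· < j)).card

theorem cc_succ (A : Finset ℕ) (j : ℕ) : cc A (j + 1) = cc A j + if j ∈ A then 1 else 0 := by
  unfold cc
  have : A.filter (· < j + 1) = A.filter (· < j) ∪ A.filter (· = j) := by
    ext x; simp only [Finset.mem_filter, Finset.mem_union]; grind
  rw [this, Finset.card_union_of_disjoint]
  · congr 1
    rw [Finset.filter_eq']
    split_ifs <;> simp
  · rw [Finset.disjoint_filter]; intro x _ h1 h2; omega

/-- basic boundary function -/
def g0 (A : Finset ℕ) (r : ℤ) : ℤ := cc A (r - 1).toNat - cc A (-r).toNat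

/-- periodic boundary function -/
def gA (α β : ℕ) (A : Finset ℕ) (k : ℤ) : ℤ :=
  α * ((k + (α / 2 + β / 2 : ℕ)) / (α + β)) +
    g0 A ((k + (α / 2 + β / 2 : ℕ)) % (α + β) - (α / 2 + β / 2 : ℕ))

theorem gA_eq (α β : ℕ) (hβ : 0 < β) (A : Finset ℕ) (q r : ℤ)
    (h1 : -(α / 2 + β / 2 : ℕ) ≤ r) (h2 : r < -(α / 2 + β / 2 : ℕ) + (α + β)) :
    gA α β A (r + (α + β) * q) = α * q + g0 A r := by
  unfold gA
  have hn : (0:ℤ) < α + β := by positivity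
  rw [show r + (α + β) * q + (α / 2 + β / 2 : ℕ) = (r + (α / 2 + β / 2 : ℕ)) + (α + β) * q by ring,
    Int.add_mul_ediv_left _ _ hn.ne', Int.add_mul_emod_self_left,
    Int.ediv_eq_zero_of_lt (by linarith) (by linarith),
    Int.emod_eq_of_lt (by linarith) (by linarith)]
  simp

theorem rep_r (α β : ℕ) (hβ : 0 < β) (k : ℤ) : ∃ q r : ℤ, k = r + (α + β) * q ∧
    -((α / 2 + β / 2 : ℕ) : ℤ) ≤ r ∧ r < -((α / 2 + β / 2 : ℕ) : ℤ) + (α + β) := by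
  have hn : (0:ℤ) < α + β := by positivity
  refine ⟨(k + (α / 2 + β / 2 : ℕ)) / (α + β),
    (k + (α / 2 + β / 2 : ℕ)) % (α + β) - (α / 2 + β / 2 : ℕ), ?_, ?_, ?_⟩
  · have := Int.emod_add_mul_ediv (k + (α / 2 + β / 2 : ℕ)) (α + β)
    linarith
  · have := Int.emod_nonneg (k + (α / 2 + β / 2 : ℕ)) hn.ne'
    linarith
  · have := Int.emod_lt_of_pos (k + (α / 2 + β / 2 : ℕ)) hn
    linarith

theorem g0_step (A : Finset ℕ) (r : ℤ) : g0 A r ≤ g0 A (r + 1) ∧ g0 A (r + 1) ≤ g0 A r + 1 := by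
  unfold g0
  rcases lt_trichotomy r 0 with h | h | h
  · have e : (-r).toNat = (-(r+1)).toNat + 1 := by omega
    have e2 : (r - 1).toNat = (r + 1 - 1).toNat := by omega
    rw [e, e2, cc_succ]
    split_ifs <;> push_cast <;> constructor <;> linarith
  · subst h; simp
  · have e : (-r).toNat = (-(r+1)).toNat := by omega
    have e2 : (r + 1 - 1).toNat = (r - 1).toNat + 1 := by omega
    rw [e, e2, cc_succ]
    split_ifs <;> push_cast <;> constructor <;> linarith

theorem g0_sym (A : Finset ℕ) (r : ℤ) : g0 A r + g0 A (1 - r) = 0 := by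
  unfold g0
  rw [show 1 - r - 1 = -r by ring, show -(1 - r) = r - 1 by ring]
  ring

theorem cc_full (A : Finset ℕ) (h : ℕ) (hA : A ⊆ Finset.range h) : cc A h = A.card := by
  unfold cc
  congr 1
  rw [Finset.filter_eq_self]
  intro x hx
  simpa using hA hx

theorem gA_GG (α β : ℕ) (hodd : Odd β) (A : Finset ℕ)
    (hA : A ∈ Finset.powersetCard (α / 2) (Finset.range (α / 2 + β / 2))) :
    GG α β (gA α β A) := by
  have hβ : 0 < β := hodd.pos
  rw [Finset.mem_powersetCard] at hA
  have hfull := cc_full A _ hA.1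
  rw [hA.2] at hfull
  have E := gA_eq α β hβ A
  obtain ⟨b, hb⟩ := hodd
  set h := α / 2 + β / 2 with hh
  have top : g0 A (h + 1) = (α / 2 : ℕ) := by
    unfold g0
    rw [show ((h : ℤ) + 1 - 1).toNat = h by omega, show (-((h:ℤ) + 1)).toNat = 0 by omega, hfull]
    simp [cc]
  have bot : g0 A (-h) = -(α / 2 : ℕ) := by
    have := g0_sym A (h + 1)
    rw [show 1 - ((h:ℤ) + 1) = -h by ring] at this
    linarith
  have per : ∀ k, gA α β A (k + (α + β)) = gA α β A k + α := by
    intro k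
    obtain ⟨q, r, rfl, h1, h2⟩ := rep_r α β hβ k
    rw [show r + (α + β) * q + (α + β) = r + (α + β) * (q + 1) by ring, E _ _ h1 h2, E _ _ h1 h2]
    ring
  have botq : ∀ q : ℤ, gA α β A (-h + (α + β) * q) = α * q - (α / 2 : ℕ) := by
    intro q
    rw [E _ _ le_rfl (by omega), bot]; ring
  refine ⟨?_, per, ?_⟩
  · intro k
    obtain ⟨q, r, rfl, h1, h2⟩ := rep_r α β hβ k
    by_cases hr : r + 1 < -(h : ℤ) + (α + β)
    · rw [show r + (α + β) * q + 1 = (r + 1) + (α + β) * q by ring, E _ _ h1 h2,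
        E _ _ (by omega) hr]
      have := g0_step A r
      constructor <;> linarith
    · have hr' : r = -h + (α + β) - 1 := by omega
      rw [E _ _ h1 h2, show r + (α + β) * q + 1 = -h + (α + β) * (q + 1) by rw [hr']; ring, botq,
        mul_add, mul_one]
      rcases Nat.even_or_odd' α with ⟨a, ha | ha⟩
      · have e : r = h := by omega
        have s := g0_step A r
        rw [e, top] at s
        rw [e]
        constructor <;> linarith [show (α:ℤ) = 2 * (α / 2 : ℕ) by omega]
      · have e : r = h + 1 := by omega
        rw [e, top]
        constructor <;> linarith [show (α:ℤ) = 2 * (α / 2 : ℕ) + 1 by omega]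
  · intro k
    obtain ⟨q, r, rfl, h1, h2⟩ := rep_r α β hβ k
    rw [E _ _ h1 h2]
    by_cases hr : 1 - r < -(h : ℤ) + (α + β)
    · rw [show 1 - (r + (α + β) * q) = (1 - r) + (α + β) * (-q) by ring, E _ _ (by omega) hr]
      have := g0_sym A r
      linarith
    · have e : r = -h := by omega
      have e2 : 1 - (r + (α + β) * q) = -h + (α + β) * (1 - q) := by
        have : (α + β : ℤ) = 2 * h + 1 := by omega
        rw [this, e]; ring
      rw [e2, botq, e, bot, mul_sub]
      linarith [show (α:ℤ) = 2 * (α / 2 : ℕ) by omega]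

theorem gA_small (α β : ℕ) (hβ : Odd β) (A : Finset ℕ) (j : ℕ) (hj : j ≤ α / 2 + β / 2)
    (hA : A ∈ Finset.powersetCard (α / 2) (Finset.range (α / 2 + β / 2))) :
    gA α β A (j + 1) = cc A j := by
  have G := gA_GG α β hβ A hA
  obtain ⟨b, hb⟩ := hβ
  have E := fun h1 h2 => gA_eq α β (by omega) A 0 (j + 1) h1 h2
  by_cases hc : (j:ℤ) + 1 < -(α / 2 + β / 2 : ℕ) + (α + β)
  · have := E (by omega) hc
    rw [mul_zero, add_zero] at this
    rw [this]
    unfold g0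
    rw [show ((j : ℤ) + 1 - 1).toNat = j by omega, show (-((j:ℤ) + 1)).toNat = 0 by omega]
    simp [cc]
  · have e : j = α / 2 + β / 2 := by omega
    have s := G.2.2 (j + 1)
    have := gA_eq α β (by omega) A 0 (-j) (by omega) (by omega)
    rw [mul_zero, add_zero] at this
    rw [show 1 - ((j:ℤ) + 1) = -j by ring, this] at s
    unfold g0 at s
    rw [show (-(j:ℤ) - 1).toNat = 0 by omega, show (-(-(j:ℤ))).toNat = j by omega] at s
    simp [cc] at s ⊢
    linarith

theorem GG_ext (α β : ℕ) (hβ : 0 < β) (g g' : ℤ → ℤ) (h : GG α β g) (h' : GG α β g')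
    (he : ∀ j : ℕ, j ≤ α / 2 + β / 2 → g (j + 1) = g' (j + 1)) : g = g' := by
  have pos : ∀ r : ℤ, 1 ≤ r → r ≤ (α / 2 + β / 2 : ℕ) + 1 → g r = g' r := by
    intro r h1 h2
    have := he (r - 1).toNat (by omega)
    rwa [show (((r - 1).toNat : ℕ) : ℤ) + 1 = r by omega] at this
  funext k
  obtain ⟨q, r, rfl, h1, h2⟩ := rep_r α β hβ k
  rw [GG_per α β g h, GG_per α β g' h']
  congr 1
  by_cases hr : 1 ≤ r
  · exact pos r hr (by omega)
  · have a := h.2.2 r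
    have b := h'.2.2 r
    have := pos (1 - r) (by omega) (by omega)
    linarith

theorem DD_inj (α β : ℕ) (hα : 0 < α) (hcop : Nat.Coprime α β) (g g' : ℤ → ℤ) (h : GG α β g)
    (h' : GG α β g') (he : DD α β g = DD α β g') : g = g' := by
  funext k
  have M := mem_DD α β hα hcop g (GG_per α β g h) k
  have M' := mem_DD α β hα hcop g' (GG_per α β g' h') k
  rw [he] at M
  have a := (M (-g k)).symm.trans (M' (-g k))
  have b := (M (-g' k)).symm.trans (M' (-g' k))
  omega

theorem ncard_TT (α β : ℕ) (hα : 0 < α) (hcop : Nat.Coprime α β) (hodd : Odd β) :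
    (TT α β).ncard = Nat.choose (α / 2 + β / 2) (α / 2) := by
  have hβ : 0 < β := hodd.pos
  have : ((Finset.powersetCard (α / 2) (Finset.range (α / 2 + β / 2)) : Finset (Finset ℕ)) :
      Set (Finset ℕ)).ncard = (TT α β).ncard := by
    refine Set.ncard_congr (fun A _ => DD α β (gA α β A)) ?_ ?_ ?_
    · intro A hA
      exact DD_mem α β hα hcop _ (gA_GG α β hodd A hA)
    · intro A B hA hB he
      have e := DD_inj α β hα hcop _ _ (gA_GG α β hodd A hA) (gA_GG α β hodd B hB) he
      have c : ∀ j ≤ α / 2 + β / 2, cc A j = cc B j := by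
        intro j hj
        have a := gA_small α β hodd A j hj hA
        rw [e, gA_small α β hodd B j hj hB] at a
        exact_mod_cast a.symm
      have hA' := (Finset.mem_powersetCard.1 hA).1
      have hB' := (Finset.mem_powersetCard.1 hB).1
      ext j
      by_cases hj : j < α / 2 + β / 2
      · have c1 := c j hj.le
        have c2 := c (j + 1) hj
        rw [cc_succ, cc_succ, c1] at c2
        by_cases ha : j ∈ A <;> by_cases hb : j ∈ B <;> simp [ha, hb] at c2 ⊢
      · have a : j ∉ A := fun h => hj (by simpa using hA' h)
        have b : j ∉ B := fun h => hj (by simpa using hB' h)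
        simp [a, b]
    · intro Δ hΔ
      obtain ⟨g, hg, rfl⟩ := TT_exists α β hα hβ hcop Δ hΔ
      set A := (Finset.range (α / 2 + β / 2)).filter (fun j : ℕ => g (j + 2) = g (j + 1) + 1)
        with hAdef
      have c : ∀ j : ℕ, j ≤ α / 2 + β / 2 → (cc A j : ℤ) = g (j + 1) := by
        intro j
        induction j with
        | zero =>
          intro _
          have a := hg.1 0
          have b := hg.2.2 0
          simp only [zero_add, sub_zero] at a b
          simp [cc]
          omega
        | succ j ih =>
          intro hj
          have a := ih (by omega)
          have s := hg.1 (j + 1)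
          rw [cc_succ]
          push_cast
          rw [a]
          rw [show (j:ℤ) + 1 + 1 = j + 2 by ring] at s ⊢
          have m : j ∈ A ↔ g (j + 2) = g (j + 1) + 1 := by
            simp [hAdef]; omega
          split_ifs with hh
          · rw [m] at hh; omega
          · rw [m] at hh; omega
      have hsub : A ⊆ Finset.range (α / 2 + β / 2) := Finset.filter_subset _ _
      have hcard : A.card = α / 2 := by
        have h1 := c _ le_rfl
        rw [cc_full A _ hsub] at h1
        set h := α / 2 + β / 2 with hh
        have h2 := hg.2.2 (h + 1)
        have h3 := hg.2.1 (-h)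
        rw [show 1 - ((h:ℤ) + 1) = -h by ring] at h2
        obtain ⟨b, hb⟩ := hodd
        rcases Nat.even_or_odd' α with ⟨a, ha | ha⟩
        · rw [show -(h:ℤ) + (α + β) = h + 1 by omega] at h3
          omega
        · rw [show -(h:ℤ) + (α + β) = h + 1 + 1 by omega] at h3
          have h4 := hg.1 (h + 1)
          omega
      have hA : A ∈ Finset.powersetCard (α / 2) (Finset.range (α / 2 + β / 2)) :=
        Finset.mem_powersetCard.2 ⟨hsub, hcard⟩
      refine ⟨A, hA, ?_⟩
      congr 1
      apply GG_ext α β hβ _ _ (gA_GG α β hodd A hA) hg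
      intro j hj
      rw [gA_small α β hodd A j hj hA, c j hj]
  rw [← this, Set.ncard_coe_finset, Finset.card_powersetCard, Finset.card_range]

theorem gamma_comm (α β : ℕ) : Gamma α β = Gamma β α := by
  ext x
  constructor <;> rintro ⟨p, q, h⟩ <;> exact ⟨q, p, by rw [h]; ring⟩

/-- (Gorsky–Mazin) There are `C(⌊α/2⌋ + ⌊β/2⌋, ⌊α/2⌋)` selfdual
`⟨α,β⟩`-semimodules. -/
theorem count_selfdual (α β : ℕ)
    (hα : 2 ≤ α) (hαβ : α < β) (hcop : Nat.Coprime α β) :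
    {Δ : Set ℤ | IsNormalizedSemimodule α β Δ ∧ IsSelfdual α β Δ}.ncard =
      Nat.choose (α / 2 + β / 2) (α / 2) := by
  rcases Nat.even_or_odd β with hb | hb
  · have ha : Odd α := by
      rw [← Nat.not_even_iff_odd]
      intro ha
      have := Nat.dvd_gcd ha.two_dvd hb.two_dvd
      rw [hcop] at this
      omega
    have e : {Δ : Set ℤ | IsNormalizedSemimodule α β Δ ∧ IsSelfdual α β Δ} =
        {Δ : Set ℤ | IsNormalizedSemimodule β α Δ ∧ IsSelfdual β α Δ} := by
      simp only [IsNormalizedSemimodule, IsSelfdual, dualSet, gamma_comm α β]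
    rw [e, ← ncard_S_TT β α (by omega) (by omega) hcop.symm ha,
      ncard_TT β α (by omega) hcop.symm ha, add_comm (β / 2), Nat.choose_symm_add]
  · rw [← ncard_S_TT α β (by omega) (by omega) hcop hb, ncard_TT α β (by omega) hcop hb]
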